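/- There is no C² function u : ℂ → ℝ satisfying Δu ≥ e^{2u} on all of ℂ; equivalently, the complex plane carries no conformal metric e^{2u}|dz|² of Gaussian curvature ≤ −1. -/

import Mathlib

/-- The Euclidean Laplacian of `u : ℂ → ℝ`, computed via second derivatives in the
directions `1` and `I`. -/
noncomputable def laplacian (u : ℂ → ℝ) (z : ℂ) : ℝ :=
  iteratedFDeriv ℝ 2 u z ![1, 1] + iteratedFDeriv ℝ 2 u z ![Complex.I, Complex.I]

open Filter Topology

theorem second_deriv_nonpos_of_isLocalMax {f f' : ℝ → ℝ} {a c : ℝ}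
    (hf : ∀ᶠ t in 𝓝 a, HasDerivAt f (f' t) t) (hf' : HasDerivAt f' c a)
    (hmax : IsLocalMax f a) : c ≤ 0 := by
  by_contra! hc
  have hderiv : deriv f =ᶠ[𝓝 a] f' := hf.mono fun t ht => ht.deriv
  have hmin : IsLocalMin f a :=
    isLocalMin_of_deriv_deriv_pos (by rwa [hderiv.deriv_eq, hf'.deriv]) hmax.deriv_eq_zero
      hf.self_of_nhds.continuousAt
  have hconst : f =ᶠ[𝓝 a] fun _ => f a := by
    filter_upwards [hmax, hmin] with t h₁ h₂ using le_antisymm h₁ h₂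
  have hzero : f' =ᶠ[𝓝 a] fun _ => 0 := by
    filter_upwards [hderiv, hconst.deriv] with t h₁ h₂
    rw [← h₁, h₂, deriv_const]
  exact hc.ne' (hf'.unique ((hasDerivAt_const a (0 : ℝ)).congr_of_eventuallyEq hzero))

section

variable {E : Type*} [NormedAddCommGroup E] [InnerProductSpace ℝ E]

/-- The second-derivative test for `u x + log (R ^ 2 - ‖x‖ ^ 2)` in a unit direction. -/
theorem iteratedFDeriv_two_le_of_isLocalMax_add_log {u : E → ℝ} (hu : ContDiff ℝ 2 u)
    {R : ℝ} {x w : E} (hw : ‖w‖ = 1) (hx : 0 < R ^ 2 - ‖x‖ ^ 2)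
    (hmax : IsLocalMax (fun y => u y + Real.log (R ^ 2 - ‖y‖ ^ 2)) x) :
    iteratedFDeriv ℝ 2 u x ![w, w] ≤
      2 / (R ^ 2 - ‖x‖ ^ 2) + 4 * inner ℝ x w ^ 2 / (R ^ 2 - ‖x‖ ^ 2) ^ 2 := by
  set s := R ^ 2 - ‖x‖ ^ 2 with hs
  set b := inner ℝ x w with hb
  have hline (t : ℝ) : HasDerivAt (fun t : ℝ => x + t • w) w t := by
    simpa using ((hasDerivAt_id t).smul_const w).const_add x
  have hnorm (t : ℝ) : R ^ 2 - ‖x + t • w‖ ^ 2 = s - 2 * b * t - t ^ 2 := by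
    rw [norm_add_sq_real, inner_smul_right, norm_smul, hw, mul_one, Real.norm_eq_abs, sq_abs]
    ring
  have hpoly (t : ℝ) : HasDerivAt (fun t : ℝ => s - 2 * b * t - t ^ 2) (-2 * b - 2 * t) t := by
    have h := (((hasDerivAt_id' t).const_mul (2 * b)).const_sub s).sub (hasDerivAt_pow 2 t)
    exact h.congr_deriv (by push_cast; ring)
  have hpos : ∀ᶠ t : ℝ in 𝓝 0, 0 < s - 2 * b * t - t ^ 2 :=
    (hpoly 0).continuousAt.eventually (lt_mem_nhds (by simpa using hx))
  have hfirst : ∀ᶠ t : ℝ in 𝓝 0, HasDerivAt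
      (fun t : ℝ => u (x + t • w) + Real.log (s - 2 * b * t - t ^ 2))
      (fderiv ℝ u (x + t • w) w + (-2 * b - 2 * t) / (s - 2 * b * t - t ^ 2)) t := by
    filter_upwards [hpos] with t ht
    exact ((hu.differentiable (by norm_num) _).hasFDerivAt.comp_hasDerivAt t (hline t)).add
      ((hpoly t).log ht.ne')
  have hsecond : HasDerivAt
      (fun t : ℝ => fderiv ℝ u (x + t • w) w + (-2 * b - 2 * t) / (s - 2 * b * t - t ^ 2))
      (iteratedFDeriv ℝ 2 u x ![w, w] + (-2 / s - 4 * b ^ 2 / s ^ 2)) 0 := by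
    have hu' : Differentiable ℝ (fderiv ℝ u) :=
      (hu.fderiv_right (m := 1) (by norm_num)).differentiable (by norm_num)
    refine HasDerivAt.add ?_ ?_
    · have h : HasDerivAt (fun t : ℝ => fderiv ℝ u (x + t • w)) (fderiv ℝ (fderiv ℝ u) x w) 0 :=
        (hu' x).hasFDerivAt.comp_hasDerivAt_of_eq 0 (hline 0) (by simp)
      exact (h.clm_apply (hasDerivAt_const 0 w)).congr_deriv (by simp [iteratedFDeriv_two_apply])
    · have hlin : HasDerivAt (fun t : ℝ => -2 * b - 2 * t) (-2) 0 := by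
        simpa using ((hasDerivAt_id (0 : ℝ)).const_mul 2).const_sub (-2 * b)
      refine (hlin.div (hpoly 0) (by simpa using hx.ne')).congr_deriv ?_
      have := hx.ne'
      simp only [mul_zero, sub_zero, ne_eq, OfNat.ofNat_ne_zero, not_false_eq_true, zero_pow]
      field_simp
      ring
  have hmax' : IsLocalMax (fun t : ℝ => u (x + t • w) + Real.log (s - 2 * b * t - t ^ 2)) 0 := by
    have htend : Tendsto (fun t : ℝ => x + t • w) (𝓝 0) (𝓝 x) := by
      simpa using (hline 0).continuousAt.tendsto
    filter_upwards [htend.eventually hmax] with t ht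
    simpa [hnorm, hs] using ht
  have h := second_deriv_nonpos_of_isLocalMax hfirst hsecond hmax'
  have hneg : -2 / s = -(2 / s) := neg_div _ _
  linarith

end

/-- The Ahlfors comparison with the hyperbolic metric of the disc of radius `R`, at the centre. -/
theorem exp_mul_le_two_of_exp_le_laplacian {u : ℂ → ℝ} (hu : ContDiff ℝ 2 u)
    (hΔ : ∀ z : ℂ, Real.exp (2 * u z) ≤ laplacian u z) {R : ℝ} (hR : 0 < R) :
    Real.exp (u 0) * R ≤ 2 := by
  obtain ⟨z, hz, hzmax⟩ := (isCompact_closedBall (0 : ℂ) R).exists_isMaxOn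
    ⟨0, by simp [hR.le]⟩
    (f := fun z => Real.exp (u z) * (R ^ 2 - ‖z‖ ^ 2))
    (by have := hu.continuous; fun_prop)
  have h₀ : Real.exp (u 0) * R ^ 2 ≤ Real.exp (u z) * (R ^ 2 - ‖z‖ ^ 2) := by
    simpa using hzmax (show (0 : ℂ) ∈ Metric.closedBall 0 R by simp [hR.le])
  have hs : 0 < R ^ 2 - ‖z‖ ^ 2 :=
    pos_of_mul_pos_right (lt_of_lt_of_le (by positivity) h₀) (Real.exp_pos _).le
  have hmax : IsLocalMax (fun y => u y + Real.log (R ^ 2 - ‖y‖ ^ 2)) z := by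
    have hcont : Continuous fun y : ℂ => R ^ 2 - ‖y‖ ^ 2 := by fun_prop
    filter_upwards [hcont.continuousAt.eventually (lt_mem_nhds hs)] with y hy
    have hy' : y ∈ Metric.closedBall 0 R := by
      rw [mem_closedBall_zero_iff]
      exact le_of_sq_le_sq (by linarith) hR.le
    have h := Real.log_le_log (by positivity) (hzmax hy')
    simpa [Real.log_mul, (Real.exp_pos _).ne', hy.ne', hs.ne'] using h
  have h₁ := iteratedFDeriv_two_le_of_isLocalMax_add_log hu (w := (1 : ℂ)) (by simp) hs hmax
  have h₂ := iteratedFDeriv_two_le_of_isLocalMax_add_log hu (w := Complex.I) (by simp) hs hmax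
  have hlap : laplacian u z ≤ (2 * R / (R ^ 2 - ‖z‖ ^ 2)) ^ 2 := by
    refine (add_le_add h₁ h₂).trans_eq ?_
    have hi : inner ℝ z 1 ^ 2 + inner ℝ z Complex.I ^ 2 = ‖z‖ ^ 2 := by
      rw [Complex.sq_norm, Complex.normSq_apply]
      simp [Complex.inner]
      ring
    have := hs.ne'
    field_simp
    linear_combination 4 * hi
  have hexp : Real.exp (u z) ≤ 2 * R / (R ^ 2 - ‖z‖ ^ 2) := by
    refine le_of_sq_le_sq ?_ (by positivity)
    rw [← Real.exp_nat_mul]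
    exact_mod_cast (hΔ z).trans hlap
  rw [le_div_iff₀ hs] at hexp
  exact le_of_mul_le_mul_right (by linarith : Real.exp (u 0) * R * R ≤ 2 * R) hR

/-- There is no C² function `u : ℂ → ℝ` with `Δu ≥ e^{2u}` on all of `ℂ`: the plane
carries no conformal metric of Gaussian curvature ≤ -1. -/
theorem no_negative_curvature_on_plane :
    ¬ ∃ u : ℂ → ℝ, ContDiff ℝ 2 u ∧ ∀ z : ℂ, Real.exp (2 * u z) ≤ laplacian u z := by
  rintro ⟨u, hu, hΔ⟩
  have hpos := Real.exp_pos (u 0)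
  have h := exp_mul_le_two_of_exp_le_laplacian hu hΔ (R := 3 / Real.exp (u 0)) (by positivity)
  rw [mul_div_cancel₀ _ hpos.ne'] at h
  norm_num at h
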